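/- arXiv:2204.02902 — 3 statements merged into one kernel-verified Lean document; each statement's English description precedes it below -/
import Mathlib

section
/- The function f(x) = (1 − e^{−x})^x is monotonically increasing on the interval [1, ∞). Consequently, for every real x ≥ 1 it holds that (1 − e^{−x})^x ≥ 1 − 1/e, with equality at x = 1. -/
theorem one_sub_exp_neg_pos {x : ℝ} (hx : 0 < x) : 0 < 1 - Real.exp (-x) := by
  rw [sub_pos, Real.exp_lt_one_iff]
  linarith

theorem hasDerivAt_log_one_sub_exp_neg_mul {x : ℝ} (hx : 0 < x) :
    HasDerivAt (fun x : ℝ => Real.log (1 - Real.exp (-x)) * x)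
      (Real.exp (-x) / (1 - Real.exp (-x)) * x + Real.log (1 - Real.exp (-x))) x := by
  have h : HasDerivAt (fun x : ℝ => 1 - Real.exp (-x)) (Real.exp (-x)) x := by
    simpa using (hasDerivAt_neg x).exp.const_sub 1
  simpa using (h.log (one_sub_exp_neg_pos hx).ne').fun_mul (hasDerivAt_id' x)

theorem monotoneOn_log_one_sub_exp_neg_mul :
    MonotoneOn (fun x : ℝ => Real.log (1 - Real.exp (-x)) * x) (Set.Ici 1) := by
  refine monotoneOn_of_hasDerivWithinAt_nonneg (convex_Ici 1)
    (fun x hx => (hasDerivAt_log_one_sub_exp_neg_mul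
      (one_pos.trans_le hx)).continuousAt.continuousWithinAt)
    (fun x hx => (hasDerivAt_log_one_sub_exp_neg_mul
      (one_pos.trans_le (interior_subset hx))).hasDerivWithinAt) fun x hx => ?_
  have hx1 : 1 ≤ x := interior_subset hx
  have hpos := one_sub_exp_neg_pos (one_pos.trans_le hx1)
  have hlog := Real.one_sub_inv_le_log_of_pos hpos
  have hinv : 1 - (1 - Real.exp (-x))⁻¹ = -(Real.exp (-x) / (1 - Real.exp (-x))) := by
    field_simp
    ring
  have hmul : Real.exp (-x) / (1 - Real.exp (-x)) ≤
      Real.exp (-x) / (1 - Real.exp (-x)) * x :=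
    le_mul_of_one_le_right (by positivity) hx1
  linarith

theorem monotoneOn_one_sub_exp_neg_rpow :
    MonotoneOn (fun x : ℝ => (1 - Real.exp (-x)) ^ x) (Set.Ici (1 : ℝ)) :=
  (Real.exp_monotone.comp_monotoneOn monotoneOn_log_one_sub_exp_neg_mul).congr fun _ hx =>
    (Real.rpow_def_of_pos (one_sub_exp_neg_pos (one_pos.trans_le hx)) _).symm

/-- The function `x ↦ (1 − e^{−x})^x` is monotonically increasing on
`[1, ∞)`; consequently `(1 − e^{−x})^x ≥ 1 − 1/e` for all `x ≥ 1`, with equality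
at `x = 1`. -/
theorem stmt9 :
    MonotoneOn (fun x : ℝ => (1 - Real.exp (-x)) ^ x) (Set.Ici (1 : ℝ)) ∧
    (∀ x : ℝ, 1 ≤ x → 1 - 1 / Real.exp 1 ≤ (1 - Real.exp (-x)) ^ x) ∧
    (1 - Real.exp (-(1 : ℝ))) ^ (1 : ℝ) = 1 - 1 / Real.exp 1 := by
  have heq : (1 - Real.exp (-(1 : ℝ))) ^ (1 : ℝ) = 1 - 1 / Real.exp 1 := by
    rw [Real.rpow_one, Real.exp_neg, one_div]
  exact ⟨monotoneOn_one_sub_exp_neg_rpow, fun x hx => heq.symm.trans_le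
    (monotoneOn_one_sub_exp_neg_rpow Set.self_mem_Ici hx hx), heq⟩
end

section
/- Let τ be an ordering of a finite set N with |N| = n, let χ : N → [1, ℓ] be a coloring with color classes Z^1, …, Z^ℓ, and for each i let z_i(j) denote the j-th element of Z^i in the order induced by τ. For an integer vector p = (p_1, …, p_ℓ) with 0 ≤ p_i ≤ |Z^i|, let N(p) := ∪_{i=1}^{ℓ} {z_i(1), …, z_i(p_i)}. Fix x ∈ [1, n] and r ∈ ℕ. Then the number of vectors p such that τ(x) ∈ N(p), N(p) ⊆ {τ(1), …, τ(x)}, and τ(j) ∈ N(p) for every j ∈ [1, x − (r+1) − 1], is at most (r + 2)^ℓ. -/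
/-- `Np τ χ p` : the set `N(p)` consisting, for every color `i`, of the first `p i`
elements of the color class of `i` in the order induced by `τ`. -/
def Np {α : Type*} [DecidableEq α] {ℓ : ℕ} (τ : List α) (χ : α → Fin ℓ)
    (p : Fin ℓ → ℕ) : Set α :=
  {v | v ∈ (τ.filter (fun u => decide (χ u = χ v))).take (p (χ v))}

theorem mem_Np_iff {α : Type*} [DecidableEq α] {ℓ : ℕ} {τ : List α} {χ : α → Fin ℓ}
    {p : Fin ℓ → ℕ} {v : α} :
    v ∈ Np τ χ p ↔ v ∈ (τ.filter (fun u => decide (χ u = χ v))).take (p (χ v)) :=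
  Iff.rfl

/-- A duplicate-free list of elements of `N(p)` has at most `p i` elements of color `i`. -/
theorem length_filter_le_of_forall_mem_Np {α : Type*} [DecidableEq α] {ℓ : ℕ} {τ l : List α}
    {χ : α → Fin ℓ} {p : Fin ℓ → ℕ} (hl : l.Nodup) (h : ∀ v ∈ l, v ∈ Np τ χ p) (i : Fin ℓ) :
    (l.filter (fun v => decide (χ v = i))).length ≤ p i := by
  have hsub : l.filter (fun v => decide (χ v = i)) ⊆
      (τ.filter (fun v => decide (χ v = i))).take (p i) := by
    intro v hv
    obtain ⟨hvl, hi⟩ := List.mem_filter.1 hv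
    obtain rfl : χ v = i := of_decide_eq_true hi
    exact mem_Np_iff.1 (h v hvl)
  exact ((hl.filter _).subperm hsub).length_le.trans (List.length_take_le _ _)

/-- If `N(p)` is contained in a list, then that list has at least `p i` elements of color `i`. -/
theorem le_length_filter_of_Np_subset {α : Type*} [DecidableEq α] {ℓ : ℕ} {τ l : List α}
    {χ : α → Fin ℓ} {p : Fin ℓ → ℕ} (hτ : τ.Nodup) (h : Np τ χ p ⊆ {v | v ∈ l}) {i : Fin ℓ}
    (hp : p i ≤ (τ.filter (fun v => decide (χ v = i))).length) :
    p i ≤ (l.filter (fun v => decide (χ v = i))).length := by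
  have hsub : (τ.filter (fun v => decide (χ v = i))).take (p i) ⊆
      l.filter (fun v => decide (χ v = i)) := by
    intro v hv
    have hi := (List.mem_filter.1 (List.mem_of_mem_take hv)).2
    obtain rfl : χ v = i := of_decide_eq_true hi
    exact List.mem_filter.2 ⟨h (mem_Np_iff.2 hv), hi⟩
  have hle := (((hτ.filter _).sublist (List.take_sublist _ _)).subperm hsub).length_le
  rwa [List.length_take, min_eq_left hp] at hle

/-- For an ordering `τ` of a finite set, a coloring `χ` with `ℓ`
colors, a position `x0` (0-based; `x = x0 + 1` in 1-based counting) and `r ∈ ℕ`, the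
number of prefix vectors `p` such that `τ(x) ∈ N(p)`, `N(p) ⊆ {τ(1), …, τ(x)}` and
`τ(j) ∈ N(p)` for all `j ∈ [1, x − (r+1) − 1]` is at most `(r + 2)^ℓ`. -/
theorem stmt10 {α : Type*} [Fintype α] [DecidableEq α]
    (τ : List α) (h1 : τ.Nodup) (hall : ∀ v, v ∈ τ)
    (ℓ : ℕ) (χ : α → Fin ℓ) (r x0 : ℕ) (hx : x0 < τ.length) :
    Set.ncard {p : Fin ℓ → ℕ |
        (∀ i, p i ≤ (τ.filter (fun v => decide (χ v = i))).length) ∧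
        τ.get ⟨x0, hx⟩ ∈ Np τ χ p ∧
        Np τ χ p ⊆ {v | v ∈ τ.take (x0 + 1)} ∧
        ∀ v ∈ τ.take (x0 + 1 - (r + 2)), v ∈ Np τ χ p}
      ≤ (r + 2) ^ ℓ := by
  set k := x0 + 1 - (r + 2) with hk
  set a := τ.get ⟨x0, hx⟩ with ha
  let A : Fin ℓ → ℕ := fun i => ((τ.take k ++ [a]).filter (fun v => decide (χ v = i))).length
  have htake : τ.take (x0 + 1) = τ.take k ++ ((τ.take x0).drop k ++ [a]) := by
    have h2 : τ.take k = (τ.take x0).take k := by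
      rw [List.take_take, min_eq_left (by omega)]
    rw [h2, ← List.append_assoc, List.take_append_drop, ha, List.get_eq_getElem,
      List.take_concat_get']
  have hnodup : (τ.take k ++ [a]).Nodup := by
    have h2 : (τ.take (x0 + 1)).Nodup := h1.sublist (List.take_sublist _ _)
    rw [htake] at h2
    exact h2.sublist ((List.Sublist.refl _).append (List.sublist_append_right _ _))
  have hsub : {p : Fin ℓ → ℕ |
        (∀ i, p i ≤ (τ.filter (fun v => decide (χ v = i))).length) ∧
        a ∈ Np τ χ p ∧
        Np τ χ p ⊆ {v | v ∈ τ.take (x0 + 1)} ∧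
        ∀ v ∈ τ.take k, v ∈ Np τ χ p} ⊆
      (Fintype.piFinset fun i => Finset.Icc (A i) (A i + (r + 1)) : Finset (Fin ℓ → ℕ)) := by
    rintro p ⟨hp, hap, hup, hlow⟩
    rw [Finset.mem_coe, Fintype.mem_piFinset]
    intro i
    refine Finset.mem_Icc.2 ⟨length_filter_le_of_forall_mem_Np (τ := τ) hnodup ?_ i, ?_⟩
    · intro v hv
      rcases List.mem_append.1 hv with hv | hv
      · exact hlow v hv
      · rwa [List.mem_singleton.1 hv]
    · have hle := le_length_filter_of_Np_subset h1 hup (hp i)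
      have hgap := List.length_filter_le (fun v => decide (χ v = i)) ((τ.take x0).drop k)
      rw [List.length_drop, List.length_take] at hgap
      rw [htake, List.filter_append, List.filter_append, List.length_append,
        List.length_append] at hle
      simp only [A, List.filter_append, List.length_append]
      omega
  refine (Set.ncard_le_ncard hsub (Finset.finite_toSet _)).trans ?_
  rw [Set.ncard_coe_finset, Fintype.card_piFinset]
  simp only [Nat.card_Icc]
  rw [Finset.prod_congr rfl fun i _ => show A i + (r + 1) + 1 - A i = r + 2 by omega]
  simp
end

section
/- Let N_1 and N_2 be disjoint finite sets, let σ_1 and σ_1′ be orderings of N_1 with InvWin(σ_1, σ_1′) ≤ r, and let σ_2 and σ_2′ be orderings of N_2 with InvWin(σ_2, σ_2′) ≤ r. Then the concatenated orderings satisfy InvWin(σ_1 · σ_2, σ_1′ · σ_2′) ≤ r. -/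
/-- Swap the two consecutive elements at (0-based) positions `i` and `i+1`. -/
def swapAdj {α : Type*} : ℕ → List α → List α
  | 0, a :: b :: l => b :: a :: l
  | n + 1, a :: l => a :: swapAdj n l
  | _, l => l

/-- Apply a sequence of inversions (given as a list of 0-based positions) to a list. -/
def applySeq {α : Type*} (S : List ℕ) (l : List α) : List α :=
  S.foldl (fun acc i => swapAdj i acc) l

/-- A sequence of inversions is valid for length `n` if every position lies in `[0, n-2]`. -/
def validSeq (n : ℕ) (S : List ℕ) : Prop := ∀ i ∈ S, i + 1 < n

/-- `chainIntervals a n W` : `W` is a list of consecutive intervals `[a₁,b₁],…,[aℓ,bℓ]`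
partitioning the positions `[a, n-1]`. -/
def chainIntervals : ℕ → ℕ → List (ℕ × ℕ) → Prop
  | a, n, [] => a = n
  | a, n, p :: W => p.1 = a ∧ p.1 ≤ p.2 ∧ p.2 < n ∧ chainIntervals (p.2 + 1) n W

/-- The width of a window partition `W` for a sequence of inversions `S`. -/
def winWidth (S : List ℕ) (W : List (ℕ × ℕ)) : ℕ :=
  W.foldr (fun p m => max (∑ j ∈ Finset.Icc p.1 p.2, S.count j) m) 0

/-- The inversion-window distance `InvWin(τ, τ')`. -/
noncomputable def InvWinDist {α : Type*} (τ τ' : List α) : ℕ :=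
  sInf {w | ∃ S : List ℕ, validSeq τ.length S ∧ applySeq S τ = τ' ∧
    ∃ W : List (ℕ × ℕ), chainIntervals 0 τ.length W ∧ (∀ p ∈ W, p.2 ∉ S) ∧
      winWidth S W = w}

@[simp]
theorem swapAdj_length {α : Type*} (i : ℕ) (l : List α) : (swapAdj i l).length = l.length := by
  induction i generalizing l with
  | zero => rcases l with _ | ⟨a, _ | ⟨b, l⟩⟩ <;> simp [swapAdj]
  | succ i ih => rcases l with _ | ⟨a, l⟩ <;> simp [swapAdj, ih]

theorem applySeq_append {α : Type*} (S T : List ℕ) (l : List α) :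
    applySeq (S ++ T) l = applySeq T (applySeq S l) := by
  simp [applySeq]

@[simp]
theorem applySeq_length {α : Type*} (S : List ℕ) (l : List α) :
    (applySeq S l).length = l.length := by
  induction S generalizing l with
  | nil => rfl
  | cons i S ih => simpa [applySeq] using ih (swapAdj i l)

theorem swapAdj_append_left {α : Type*} {i : ℕ} {l : List α} (m : List α)
    (h : i + 1 < l.length) : swapAdj i (l ++ m) = swapAdj i l ++ m := by
  induction i generalizing l with
  | zero =>
    rcases l with _ | ⟨a, _ | ⟨b, l⟩⟩
    · simp at h
    · simp at h
    · rfl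
  | succ i ih =>
    rcases l with _ | ⟨a, l⟩
    · simp at h
    · simpa [swapAdj] using ih (by simpa using h)

theorem swapAdj_append_right {α : Type*} (i : ℕ) (l m : List α) :
    swapAdj (l.length + i) (l ++ m) = l ++ swapAdj i m := by
  induction l with
  | nil => simp
  | cons a l ih =>
    rw [List.length_cons, Nat.add_right_comm]
    simpa [swapAdj] using ih

theorem applySeq_append_left {α : Type*} {S : List ℕ} {l : List α} (m : List α)
    (h : validSeq l.length S) : applySeq S (l ++ m) = applySeq S l ++ m := by
  induction S generalizing l with
  | nil => rfl
  | cons i S ih =>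
    have hS : validSeq (swapAdj i l).length S := by
      simpa [validSeq] using fun j hj => h j (List.mem_cons_of_mem _ hj)
    have hi := swapAdj_append_left m (h i List.mem_cons_self)
    simpa [applySeq, hi] using ih hS

theorem applySeq_append_right {α : Type*} (S : List ℕ) (l m : List α) :
    applySeq (S.map (l.length + ·)) (l ++ m) = l ++ applySeq S m := by
  induction S generalizing m with
  | nil => rfl
  | cons i S ih => simpa [applySeq, swapAdj_append_right] using ih (swapAdj i m)

theorem validSeq.append_map {m n : ℕ} {S T : List ℕ} (hS : validSeq m S) (hT : validSeq n T) :
    validSeq (m + n) (S ++ T.map (m + ·)) := by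
  intro i hi
  rcases List.mem_append.1 hi with hi | hi
  · have := hS i hi
    lia
  · obtain ⟨j, hj, rfl⟩ := List.mem_map.1 hi
    have := hT j hj
    lia

theorem chainIntervals.le {a n : ℕ} {W : List (ℕ × ℕ)} (h : chainIntervals a n W) : a ≤ n := by
  induction W generalizing a with
  | nil => exact le_of_eq h
  | cons p W ih =>
    obtain ⟨h1, h2, h3, -⟩ := h
    lia

theorem chainIntervals.snd_lt {a n : ℕ} {W : List (ℕ × ℕ)} (h : chainIntervals a n W) :
    ∀ p ∈ W, p.2 < n := by
  induction W generalizing a with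
  | nil => simp
  | cons p W ih =>
    obtain ⟨-, -, h3, h4⟩ := h
    simpa using ⟨h3, fun x y hxy => ih h4 (x, y) hxy⟩

theorem chainIntervals.append {a b c : ℕ} {V W : List (ℕ × ℕ)} (hV : chainIntervals a b V)
    (hW : chainIntervals b c W) : chainIntervals a c (V ++ W) := by
  induction V generalizing a with
  | nil =>
    obtain rfl : a = b := hV
    exact hW
  | cons p V ih =>
    obtain ⟨h1, h2, h3, h4⟩ := hV
    exact ⟨h1, h2, h3.trans_le hW.le, ih h4⟩

theorem chainIntervals.map_add {a n : ℕ} {W : List (ℕ × ℕ)} (k : ℕ) (h : chainIntervals a n W) :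
    chainIntervals (k + a) (k + n) (W.map fun p => (k + p.1, k + p.2)) := by
  induction W generalizing a with
  | nil => exact congrArg (k + ·) h
  | cons p W ih =>
    obtain ⟨h1, h2, h3, h4⟩ := h
    exact ⟨congrArg (k + ·) h1, Nat.add_le_add_left h2 k, Nat.add_lt_add_left h3 k, ih h4⟩

theorem winWidth_le_iff {S : List ℕ} {W : List (ℕ × ℕ)} {r : ℕ} :
    winWidth S W ≤ r ↔ ∀ p ∈ W, ∑ j ∈ Finset.Icc p.1 p.2, S.count j ≤ r := by
  induction W with
  | nil => simp [winWidth]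
  | cons p W ih =>
    rw [List.forall_mem_cons, ← ih]
    exact max_le_iff

theorem winWidth_append_map_le {m r : ℕ} {S T : List ℕ} {V W : List (ℕ × ℕ)}
    (hS : validSeq m S) (hV : ∀ p ∈ V, p.2 < m)
    (hSV : winWidth S V ≤ r) (hTW : winWidth T W ≤ r) :
    winWidth (S ++ T.map (m + ·)) (V ++ W.map fun p => (m + p.1, m + p.2)) ≤ r := by
  rw [winWidth_le_iff] at *
  intro p hp
  rcases List.mem_append.1 hp with hp | hp
  · refine le_of_eq_of_le (Finset.sum_congr rfl fun j hj => ?_) (hSV p hp)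
    have hjm := (Finset.mem_Icc.1 hj).2.trans_lt (hV p hp)
    have hj0 : (T.map (m + ·)).count j = 0 := by
      refine List.count_eq_zero.2 fun hmem => ?_
      obtain ⟨i, -, rfl⟩ := List.mem_map.1 hmem
      lia
    rw [List.count_append, hj0, Nat.add_zero]
  · obtain ⟨q, hq, rfl⟩ := List.mem_map.1 hp
    refine le_of_eq_of_le ?_ (hTW q hq)
    rw [← Finset.map_add_left_Icc, Finset.sum_map]
    refine Finset.sum_congr rfl fun j _ => ?_
    have hj0 : S.count (m + j) = 0 := by
      refine List.count_eq_zero.2 fun hmem => ?_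
      have := hS _ hmem
      lia
    rw [addLeftEmbedding_apply, List.count_append, hj0, Nat.zero_add]
    exact List.count_map_of_injective T (m + ·) (add_right_injective m) j

theorem List.Perm.exists_applySeq_eq {α : Type*} {l l' : List α} (h : l.Perm l') :
    ∃ S, validSeq l.length S ∧ applySeq S l = l' := by
  induction h with
  | nil => exact ⟨[], by simp [validSeq], rfl⟩
  | cons a _ ih =>
    obtain ⟨S, hS, rfl⟩ := ih
    refine ⟨S.map (1 + ·), ?_, applySeq_append_right S [a] _⟩
    simpa [validSeq, Nat.add_comm] using hS
  | swap a b l => exact ⟨[0], by simp [validSeq], rfl⟩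
  | trans _ _ ih₁ ih₂ =>
    obtain ⟨S, hS, rfl⟩ := ih₁
    obtain ⟨T, hT, rfl⟩ := ih₂
    rw [applySeq_length] at hT
    refine ⟨S ++ T, fun i hi => ?_, applySeq_append S T _⟩
    exact (List.mem_append.1 hi).elim (hS i) (hT i)

theorem validSeq.exists_chainIntervals {n : ℕ} {S : List ℕ} (hS : validSeq n S) :
    ∃ W, chainIntervals 0 n W ∧ ∀ p ∈ W, p.2 ∉ S := by
  cases n with
  | zero => exact ⟨[], rfl, by simp⟩
  | succ n =>
    refine ⟨[(0, n)], by simp [chainIntervals], ?_⟩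
    simpa using fun hn => absurd (hS n hn) (lt_irrefl _)

theorem exists_winWidth_le_of_InvWinDist_le {α : Type*} {σ σ' : List α} {r : ℕ}
    (hp : σ.Perm σ') (hr : InvWinDist σ σ' ≤ r) :
    ∃ S, validSeq σ.length S ∧ applySeq S σ = σ' ∧
      ∃ W, chainIntervals 0 σ.length W ∧ (∀ p ∈ W, p.2 ∉ S) ∧ winWidth S W ≤ r := by
  obtain ⟨S, hS, hl⟩ := hp.exists_applySeq_eq
  obtain ⟨W, hW, hWS⟩ := hS.exists_chainIntervals
  obtain ⟨S, hS, hl, W, hW, hWS, hw⟩ := Nat.sInf_mem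
    (s := {w | ∃ S : List ℕ, validSeq σ.length S ∧ applySeq S σ = σ' ∧
      ∃ W : List (ℕ × ℕ), chainIntervals 0 σ.length W ∧ (∀ p ∈ W, p.2 ∉ S) ∧ winWidth S W = w})
    ⟨_, S, hS, hl, W, hW, hWS, rfl⟩
  exact ⟨S, hS, hl, W, hW, hWS, hw.trans_le hr⟩

/-- For orderings of disjoint sets, if `InvWin(σ₁, σ₁') ≤ r` and
`InvWin(σ₂, σ₂') ≤ r`, then `InvWin(σ₁ · σ₂, σ₁' · σ₂') ≤ r`. -/
theorem stmt13 {α : Type*} (σ₁ σ₁' σ₂ σ₂' : List α) (r : ℕ)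
    (h1 : σ₁.Nodup) (h1' : σ₁'.Nodup) (h2 : σ₂.Nodup) (h2' : σ₂'.Nodup)
    (hdisj : ∀ x ∈ σ₁, x ∉ σ₂)
    (hp1 : σ₁.Perm σ₁') (hp2 : σ₂.Perm σ₂')
    (hw1 : InvWinDist σ₁ σ₁' ≤ r) (hw2 : InvWinDist σ₂ σ₂' ≤ r) :
    InvWinDist (σ₁ ++ σ₂) (σ₁' ++ σ₂') ≤ r := by
  obtain ⟨S, hS, rfl, V, hV, hVS, hSV⟩ := exists_winWidth_le_of_InvWinDist_le hp1 hw1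
  obtain ⟨T, hT, rfl, W, hW, hWT, hTW⟩ := exists_winWidth_le_of_InvWinDist_le hp2 hw2
  refine le_trans (Nat.sInf_le ⟨S ++ T.map (σ₁.length + ·), ?_, ?_,
    V ++ W.map (fun p => (σ₁.length + p.1, σ₁.length + p.2)), ?_, ?_, rfl⟩)
    (winWidth_append_map_le hS hV.snd_lt hSV hTW)
  · simpa using hS.append_map hT
  · rw [applySeq_append, applySeq_append_left σ₂ hS]
    simpa using applySeq_append_right T (applySeq S σ₁) σ₂
  · simpa using hV.append (hW.map_add σ₁.length)
  · intro p hp hmem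
    rcases List.mem_append.1 hp with hp | hp
    · rcases List.mem_append.1 hmem with hmem | hmem
      · exact hVS p hp hmem
      · obtain ⟨i, -, hi⟩ := List.mem_map.1 hmem
        have := hV.snd_lt p hp
        lia
    · obtain ⟨q, hq, rfl⟩ := List.mem_map.1 hp
      rcases List.mem_append.1 hmem with hmem | hmem
      · have := hS _ hmem
        lia
      · obtain ⟨i, hi, heq⟩ := List.mem_map.1 hmem
        exact hWT q hq (Nat.add_left_cancel heq ▸ hi)
end
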